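/- Let x ∈ 𝒟 satisfy E_f(x) < 1/a, where a = (n−1)^{1/q}. Then 1 + σ_i(x) ≠ 0 for every i (so x lies in the domain of the Ehrlich iteration function Φ), and ‖x − Φ(x)‖ ⪯ γ(E_f(x))·‖W_f(x)‖ coordinatewise, where γ(t) = 1/(1 − a t). (Lemma 3.1) -/

import Mathlib

open Finset Polynomial Filter

noncomputable section

/-- The Weierstrass correction `W_i(x) = f(x_i)/(C₀ ∏_{j≠i}(x_i − x_j))`. -/
def Wc {n : ℕ} {K : Type*} [NormedField K] (f : Polynomial K) (x : Fin n → K) (i : Fin n) : K :=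
  eval (x i) f / (f.leadingCoeff * ∏ j ∈ univ.erase i, (x i - x j))

/-- `dmin x i = min_{j ≠ i} ‖x i - x j‖`. -/
def dmin {n : ℕ} {K : Type*} [NormedField K] (x : Fin n → K) (i : Fin n) : ℝ :=
  if h : (univ.erase i).Nonempty then (univ.erase i).inf' h fun j => ‖x i - x j‖ else 0

/-- `E_f(x)` : the ℓ^p norm of the vector `(‖W_i(x)‖ / d_i(x))_i`. -/
def Ef {n : ℕ} {K : Type*} [NormedField K] (p : ENNReal) (f : Polynomial K)
    (x : Fin n → K) : ℝ :=
  ‖(WithLp.equiv p (Fin n → ℝ)).symm (fun i => ‖Wc f x i‖ / dmin x i)‖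

/-- `σ_i(x) = Σ_{j≠i} W_j(x)/(x_i − x_j)`. -/
def sigmaf {n : ℕ} {K : Type*} [NormedField K] (f : Polynomial K) (x : Fin n → K)
    (i : Fin n) : K :=
  ∑ j ∈ univ.erase i, Wc f x j / (x i - x j)

/-- The Ehrlich iteration function. -/
def PhiE {n : ℕ} {K : Type*} [NormedField K] (f : Polynomial K) (x : Fin n → K) : Fin n → K :=
  fun i => x i - Wc f x i / (1 + sigmaf f x i)

/-- The Prešić–Tanabe iteration function. -/
def TnbE {n : ℕ} {K : Type*} [NormedField K] (f : Polynomial K) (x : Fin n → K) : Fin n → K :=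
  fun i => x i - Wc f x i * (1 - sigmaf f x i)

/-- `ξ` is a root vector of `f`, i.e. `f(z) = C₀ ∏ (z − ξᵢ)`. -/
def IsRootVector {n : ℕ} {K : Type*} [NormedField K] (f : Polynomial K) (ξ : Fin n → K) : Prop :=
  f = C f.leadingCoeff * ∏ i, (X - C (ξ i))

/-- `E_f(x)` in the case `p = ∞`: the max of `‖W_i(x)‖ / d_i(x)`. -/
def Einf {n : ℕ} {K : Type*} [NormedField K] (f : Polynomial K) (x : Fin n → K) : ℝ :=
  if h : (univ : Finset (Fin n)).Nonempty then univ.sup' h fun i => ‖Wc f x i‖ / dmin x i else 0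

/-- Hölder's inequality for a partial sum of the coordinates of a vector in `ℓ^p`. -/
theorem sum_le_card_rpow_mul_norm {ι : Type*} [Fintype ι] {p q : ENNReal} (hp : 1 ≤ p)
    (hpq : p⁻¹ + q⁻¹ = 1) (s : Finset ι) (u : PiLp p fun _ : ι => ℝ) (hu : ∀ i, 0 ≤ u i) :
    ∑ i ∈ s, u i ≤ (s.card : ℝ) ^ (ENNReal.toReal q⁻¹) * ‖u‖ := by
  rcases eq_or_ne p ⊤ with rfl | hpt
  · have hq : q⁻¹ = 1 := by simpa using hpq
    rw [hq, ENNReal.toReal_one, Real.rpow_one, PiLp.norm_eq_ciSup, ← nsmul_eq_mul]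
    refine Finset.sum_le_card_nsmul _ _ _ fun i _ => ?_
    exact (Real.le_norm_self _).trans
      (le_ciSup (f := fun i => ‖u i‖) (Set.finite_range _).bddAbove i)
  · have hr : 1 ≤ p.toReal := by
      simpa using ENNReal.toReal_mono hpt hp
    have hr0 : 0 < p.toReal := one_pos.trans_le hr
    have hq : ENNReal.toReal q⁻¹ = (p.toReal - 1) * p.toReal⁻¹ := by
      have hqt : q⁻¹ ≠ ⊤ := fun h => by simp [h] at hpq
      have hpt' : p⁻¹ ≠ ⊤ := fun h => by simp [h] at hpq
      have h := congrArg ENNReal.toReal hpq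
      rw [ENNReal.toReal_add hpt' hqt, ENNReal.toReal_inv p, ENNReal.toReal_one] at h
      rw [sub_mul, mul_inv_cancel₀ hr0.ne']
      linarith
    have hc : (0 : ℝ) ≤ s.card := Nat.cast_nonneg _
    have hsum : 0 ≤ ∑ i, ‖u i‖ ^ p.toReal := by positivity
    have h : (∑ i ∈ s, u i) ^ p.toReal ≤
        (s.card : ℝ) ^ (p.toReal - 1) * ∑ i, ‖u i‖ ^ p.toReal := by
      calc (∑ i ∈ s, u i) ^ p.toReal
          = (∑ i ∈ s, |u i|) ^ p.toReal := by simp only [abs_of_nonneg (hu _)]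
        _ ≤ (s.card : ℝ) ^ (p.toReal - 1) * ∑ i ∈ s, |u i| ^ p.toReal :=
            Real.rpow_sum_le_const_mul_sum_rpow s (fun i => u i) hr
        _ ≤ _ := by
            refine mul_le_mul_of_nonneg_left ?_ (Real.rpow_nonneg hc _)
            exact Finset.sum_le_sum_of_subset_of_nonneg (Finset.subset_univ s)
              fun i _ _ => Real.rpow_nonneg (abs_nonneg _) _
    rw [PiLp.norm_eq_sum hr0, hq, Real.rpow_mul hc, one_div,
      ← Real.mul_rpow (Real.rpow_nonneg hc _) hsum]
    rw [← Real.rpow_rpow_inv (Finset.sum_nonneg fun i _ => hu i) hr0.ne']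
    exact Real.rpow_le_rpow (Real.rpow_nonneg (Finset.sum_nonneg fun i _ => hu i) _) h
      (inv_nonneg.2 hr0.le)

theorem dmin_pos {n : ℕ} {K : Type*} [NormedField K] (hn : 2 ≤ n) {x : Fin n → K}
    (hx : Function.Injective x) (i : Fin n) : 0 < dmin x i := by
  have : Nontrivial (Fin n) := Fin.nontrivial_iff_two_le.2 hn
  obtain ⟨j, hj⟩ := exists_ne i
  have h : (univ.erase i).Nonempty := ⟨j, by simp [hj]⟩
  rw [dmin, dif_pos h, Finset.lt_inf'_iff]
  intro k hk
  exact norm_pos_iff.2 (sub_ne_zero.2 fun h => (Finset.ne_of_mem_erase hk) (hx h).symm)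

theorem dmin_le_norm_sub {n : ℕ} {K : Type*} [NormedField K] (x : Fin n → K) {i j : Fin n}
    (hij : j ≠ i) : dmin x i ≤ ‖x i - x j‖ := by
  have hj : j ∈ univ.erase i := by simp [hij]
  rw [dmin, dif_pos ⟨j, hj⟩]
  exact Finset.inf'_le _ hj

theorem norm_sigmaf_le {n : ℕ} {K : Type*} [NormedField K] (hn : 2 ≤ n) (f : Polynomial K)
    {p q : ENNReal} (hp : 1 ≤ p) (hpq : p⁻¹ + q⁻¹ = 1) {x : Fin n → K}
    (hx : Function.Injective x) (i : Fin n) :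
    ‖sigmaf f x i‖ ≤ ((n : ℝ) - 1) ^ (ENNReal.toReal q⁻¹) * Ef p f x := by
  have hcard : (((univ : Finset (Fin n)).erase i).card : ℝ) = (n : ℝ) - 1 := by
    rw [Finset.card_erase_of_mem (mem_univ i), Finset.card_univ, Fintype.card_fin,
      Nat.cast_sub (by lia), Nat.cast_one]
  calc ‖sigmaf f x i‖ ≤ ∑ j ∈ univ.erase i, ‖Wc f x j / (x i - x j)‖ := norm_sum_le _ _
    _ ≤ ∑ j ∈ univ.erase i, ‖Wc f x j‖ / dmin x j := by
        refine Finset.sum_le_sum fun j hj => ?_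
        rw [norm_div, norm_sub_rev]
        exact div_le_div_of_nonneg_left (norm_nonneg _) (dmin_pos hn hx j)
          (dmin_le_norm_sub x (Finset.ne_of_mem_erase hj).symm)
    _ ≤ _ := by
        rw [← hcard]
        exact sum_le_card_rpow_mul_norm hp hpq _
          (WithLp.toLp p fun j => ‖Wc f x j‖ / dmin x j)
          fun j => div_nonneg (norm_nonneg _) (dmin_pos hn hx j).le

/-- Proinov, Lemma 3.1. -/
theorem stmt_9 {n : ℕ} {K : Type*} [NormedField K] [CompleteSpace K] (hn : 2 ≤ n)
    (f : Polynomial K) (hdeg : f.degree = (n : ℕ))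
    (p q : ENNReal) (hp : 1 ≤ p) (hpq : p⁻¹ + q⁻¹ = 1)
    (a : ℝ) (ha : a = ((n : ℝ) - 1) ^ (ENNReal.toReal q⁻¹))
    (x : Fin n → K) (hx : Function.Injective x)
    (hE : Ef p f x < 1 / a) :
    (∀ i : Fin n, (1 : K) + sigmaf f x i ≠ 0) ∧
    ∀ i : Fin n, ‖x i - PhiE f x i‖ ≤ 1 / (1 - a * Ef p f x) * ‖Wc f x i‖ := by
  have ha0 : 0 < a := by
    rw [ha]
    have : (2 : ℝ) ≤ n := by exact_mod_cast hn
    exact Real.rpow_pos_of_pos (by linarith) _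
  have hpos : 0 < 1 - a * Ef p f x := by
    rw [lt_div_iff₀ ha0] at hE
    linarith
  have hlow (i : Fin n) : 1 - a * Ef p f x ≤ ‖1 + sigmaf f x i‖ := by
    have h1 : ‖sigmaf f x i‖ ≤ a * Ef p f x := ha ▸ norm_sigmaf_le hn f hp hpq hx i
    have h2 := norm_sub_le_norm_add (1 : K) (sigmaf f x i)
    rw [norm_one] at h2
    linarith
  refine ⟨fun i => norm_pos_iff.1 (hpos.trans_le (hlow i)), fun i => ?_⟩
  rw [PhiE, sub_sub_cancel, norm_div, one_div_mul_eq_div]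
  exact div_le_div_of_nonneg_left (norm_nonneg _) hpos (hlow i)
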